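/- Assume the class of independent squares is symmetric, the functoriality satisfies 𝒞-independence, and specialized morphisms are stable under independent pullbacks. Let 𝔹 be a stably oriented bivariant theory over this functoriality. Then there exists a unique orientation preserving Grothendieck transformation η : 𝕄 → 𝔹 from the universal bivariant theory 𝕄 to 𝔹; necessarily η([V →f X]) = f_*(θ_𝔹(g)), where g : V → Y denotes the composite. -/

import Mathlib

open CategoryTheory CategoryTheory.Limits

universe w w' u' v u

/-- A bivariant functoriality on a category `C` with a final object and all fiber
products: a class of confined morphisms (containing all isomorphisms, closed under
composition and pullback), a class of independent Cartesian squares (containing all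
squares in which one pair of parallel sides consists of identities, closed under
horizontal and vertical composition) and a class of specialized morphisms
(containing all isomorphisms and closed under composition).

A square is recorded by its bottom `bot : X ⟶ Y`, top `top : X' ⟶ Y'`, left
vertical `l : X' ⟶ X` and right vertical `r : Y' ⟶ Y`; it is Cartesian when
`IsPullback top l r bot` holds. -/
structure BivFun (C : Type u) [Category.{v} C] where
  pt : C
  isTerminal_pt : IsTerminal pt
  hasPullbacks : HasPullbacks C
  confined : ∀ ⦃X Y : C⦄, (X ⟶ Y) → Prop
  confined_of_isIso : ∀ ⦃X Y : C⦄ (f : X ⟶ Y), IsIso f → confined f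
  confined_comp : ∀ ⦃X Y Z : C⦄ {f : X ⟶ Y} {g : Y ⟶ Z},
    confined f → confined g → confined (f ≫ g)
  confined_pullback : ∀ ⦃X Y X' Y' : C⦄ {bot : X ⟶ Y} {top : X' ⟶ Y'} {l : X' ⟶ X}
    {r : Y' ⟶ Y}, IsPullback top l r bot → confined bot → confined top
  indep : ∀ ⦃X Y X' Y' : C⦄ (bot : X ⟶ Y) (top : X' ⟶ Y') (l : X' ⟶ X) (r : Y' ⟶ Y), Prop
  indep_isPullback : ∀ ⦃X Y X' Y' : C⦄ {bot : X ⟶ Y} {top : X' ⟶ Y'} {l : X' ⟶ X}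
    {r : Y' ⟶ Y}, indep bot top l r → IsPullback top l r bot
  indep_vert_id : ∀ ⦃X Y : C⦄ (f : X ⟶ Y), indep f f (𝟙 X) (𝟙 Y)
  indep_horiz_id : ∀ ⦃X Y : C⦄ (f : X ⟶ Y), indep (𝟙 Y) (𝟙 X) f f
  indep_vcomp : ∀ ⦃X Y X' Y' X'' Y'' : C⦄ {f : X ⟶ Y} {f' : X' ⟶ Y'} {f'' : X'' ⟶ Y''}
    {l : X' ⟶ X} {r : Y' ⟶ Y} {l' : X'' ⟶ X'} {r' : Y'' ⟶ Y'},
    indep f f' l r → indep f' f'' l' r' → indep f f'' (l' ≫ l) (r' ≫ r)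
  indep_hcomp : ∀ ⦃X Y Z X' Y' Z' : C⦄ {f : X ⟶ Y} {g : Y ⟶ Z} {f' : X' ⟶ Y'}
    {g' : Y' ⟶ Z'} {l : X' ⟶ X} {m : Y' ⟶ Y} {r : Z' ⟶ Z},
    indep f f' l m → indep g g' m r → indep (f ≫ g) (f' ≫ g') l r
  specialized : ∀ ⦃X Y : C⦄, (X ⟶ Y) → Prop
  specialized_of_isIso : ∀ ⦃X Y : C⦄ (f : X ⟶ Y), IsIso f → specialized f
  specialized_comp : ∀ ⦃X Y Z : C⦄ {f : X ⟶ Y} {g : Y ⟶ Z},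
    specialized f → specialized g → specialized (f ≫ g)

variable {C : Type u} [Category.{v} C]

/-- The structure morphism to the final object `pt`. -/
def BivFun.tm (F : BivFun C) (X : C) : X ⟶ F.pt := F.isTerminal_pt.from X

/-- The data of a bivariant theory with functoriality `F`: an abelian group for every
morphism, bivariant pushforwards along confined morphisms, bivariant pullbacks along
independent squares, bivariant products, and units. -/
structure BivData (F : BivFun C) where
  grp : ∀ ⦃X Y : C⦄, (X ⟶ Y) → Type w
  addCommGroup : ∀ ⦃X Y : C⦄ (f : X ⟶ Y), AddCommGroup (grp f)
  push : ∀ ⦃X X' Y : C⦄ (g : X ⟶ X') (h : X' ⟶ Y), F.confined g → grp (g ≫ h) → grp h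
  pull : ∀ ⦃X Y X' Y' : C⦄ {bot : X ⟶ Y} {top : X' ⟶ Y'} {l : X' ⟶ X} {r : Y' ⟶ Y},
    F.indep bot top l r → grp bot → grp top
  mul : ∀ ⦃X Y Z : C⦄ {f : X ⟶ Y} {g : Y ⟶ Z}, grp f → grp g → grp (f ≫ g)
  one : ∀ (X : C), grp (𝟙 X)

attribute [instance] BivData.addCommGroup

variable {F : BivFun C}

/-- Transport of bivariant elements along an equality of morphisms. -/
def BivData.tr (B : BivData.{w} F) {X Y : C} {f g : X ⟶ Y} (h : f = g) :
    B.grp f → B.grp g := fun a => h ▸ a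

/-- The Fulton–MacPherson bivariant axioms. -/
structure IsBivTheory (B : BivData.{w} F) : Prop where
  push_add : ∀ ⦃X X' Y : C⦄ (g : X ⟶ X') (h : X' ⟶ Y) (hg : F.confined g)
    (α β : B.grp (g ≫ h)), B.push g h hg (α + β) = B.push g h hg α + B.push g h hg β
  pull_add : ∀ ⦃X Y X' Y' : C⦄ {bot : X ⟶ Y} {top : X' ⟶ Y'} {l : X' ⟶ X} {r : Y' ⟶ Y}
    (hsq : F.indep bot top l r) (α β : B.grp bot),
    B.pull hsq (α + β) = B.pull hsq α + B.pull hsq β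
  mul_add_left : ∀ ⦃X Y Z : C⦄ {f : X ⟶ Y} {g : Y ⟶ Z} (α α' : B.grp f) (β : B.grp g),
    B.mul (α + α') β = B.mul α β + B.mul α' β
  mul_add_right : ∀ ⦃X Y Z : C⦄ {f : X ⟶ Y} {g : Y ⟶ Z} (α : B.grp f) (β β' : B.grp g),
    B.mul α (β + β') = B.mul α β + B.mul α β'
  mul_assoc : ∀ ⦃X Y Z W : C⦄ {f : X ⟶ Y} {g : Y ⟶ Z} {h : Z ⟶ W}
    (α : B.grp f) (β : B.grp g) (γ : B.grp h),
    B.mul (B.mul α β) γ = B.tr (Category.assoc f g h).symm (B.mul α (B.mul β γ))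
  push_id : ∀ ⦃X Y : C⦄ (f : X ⟶ Y) (h1 : F.confined (𝟙 X)) (α : B.grp (𝟙 X ≫ f)),
    B.push (𝟙 X) f h1 α = B.tr (Category.id_comp f) α
  push_comp : ∀ ⦃X X' X'' Y : C⦄ (f : X ⟶ X') (g : X' ⟶ X'') (h : X'' ⟶ Y)
    (hf : F.confined f) (hg : F.confined g) (α : B.grp (f ≫ g ≫ h)),
    B.push g h hg (B.push f (g ≫ h) hf α) =
      B.push (f ≫ g) h (F.confined_comp hf hg) (B.tr (Category.assoc f g h).symm α)
  pull_id : ∀ ⦃X Y : C⦄ (f : X ⟶ Y) (α : B.grp f), B.pull (F.indep_vert_id f) α = α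
  pull_comp : ∀ ⦃X Y X' Y' X'' Y'' : C⦄ {f : X ⟶ Y} {f' : X' ⟶ Y'} {f'' : X'' ⟶ Y''}
    {l : X' ⟶ X} {r : Y' ⟶ Y} {l' : X'' ⟶ X'} {r' : Y'' ⟶ Y'}
    (h1 : F.indep f f' l r) (h2 : F.indep f' f'' l' r') (α : B.grp f),
    B.pull h2 (B.pull h1 α) = B.pull (F.indep_vcomp h1 h2) α
  push_mul : ∀ ⦃X X' Y Z : C⦄ (f : X ⟶ X') (h : X' ⟶ Y) (g : Y ⟶ Z) (hf : F.confined f)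
    (α : B.grp (f ≫ h)) (β : B.grp g),
    B.push f (h ≫ g) hf (B.tr (Category.assoc f h g) (B.mul α β)) =
      B.mul (B.push f h hf α) β
  pull_mul : ∀ ⦃X Y Z X' Y' Z' : C⦄ {f : X ⟶ Y} {g : Y ⟶ Z} {f' : X' ⟶ Y'} {g' : Y' ⟶ Z'}
    {l : X' ⟶ X} {m : Y' ⟶ Y} {r : Z' ⟶ Z}
    (h1 : F.indep f f' l m) (h2 : F.indep g g' m r) (α : B.grp f) (β : B.grp g),
    B.pull (F.indep_hcomp h1 h2) (B.mul α β) = B.mul (B.pull h1 α) (B.pull h2 β)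
  push_pull : ∀ ⦃X Y Z X' Y' Z' : C⦄ (f : X ⟶ Y) (k : Y ⟶ Z) (f' : X' ⟶ Y') (k' : Y' ⟶ Z')
    (l : X' ⟶ X) (m : Y' ⟶ Y) (r : Z' ⟶ Z) (hf : F.confined f)
    (hleft : IsPullback f' l m f) (hbig : F.indep (f ≫ k) (f' ≫ k') l r)
    (hright : F.indep k k' m r) (α : B.grp (f ≫ k)),
    B.pull hright (B.push f k hf α) =
      B.push f' k' (F.confined_pullback hleft hf) (B.pull hbig α)
  proj_formula : ∀ ⦃X Y X' Y' Z : C⦄ {b : X' ⟶ Y'} {t : X ⟶ Y} {g' : X ⟶ X'} {g : Y ⟶ Y'}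
    (hsq : F.indep b t g' g) (hg : F.confined g) (c : Y' ⟶ Z)
    (α : B.grp (g ≫ c)) (β : B.grp b),
    B.push g' (b ≫ c) (F.confined_pullback (F.indep_isPullback hsq).flip hg)
        (B.tr (by rw [← Category.assoc, (F.indep_isPullback hsq).w, Category.assoc])
          (B.mul (B.pull hsq β) α)) =
      B.mul β (B.push g c hg α)
  one_mul : ∀ ⦃X Y : C⦄ {f : X ⟶ Y} (α : B.grp f),
    B.tr (Category.id_comp f) (B.mul (B.one X) α) = α
  mul_one : ∀ ⦃X Y : C⦄ {f : X ⟶ Y} (α : B.grp f),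
    B.tr (Category.comp_id f) (B.mul α (B.one Y)) = α

/-- The cohomology pullback `f^* : 𝔹^•(Y) → 𝔹^•(X)` along an arbitrary morphism, using
the independent square whose horizontal sides are `f` and whose vertical sides are
identities. -/
def cohPull (B : BivData.{w} F) {X Y : C} (f : X ⟶ Y) : B.grp (𝟙 Y) → B.grp (𝟙 X) :=
  B.pull (F.indep_horiz_id f)

/-- The ring multiplication on the cohomology `𝔹^•(X) = 𝔹(𝟙 X)`. -/
def cohMul (B : BivData.{w} F) {X : C} (α β : B.grp (𝟙 X)) : B.grp (𝟙 X) :=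
  B.tr (Category.id_comp (𝟙 X)) (B.mul α β)

/-- The homology pushforward `f_* : 𝔹_•(X) → 𝔹_•(Y)` along a confined morphism. -/
def homPush (B : BivData.{w} F) {X Y : C} (f : X ⟶ Y) (hf : F.confined f) :
    B.grp (F.tm X) → B.grp (F.tm Y) :=
  fun a => B.push f (F.tm Y) hf (B.tr (F.isTerminal_pt.hom_ext _ _) a)

/-- The left action of the cohomology ring `𝔹^•(X)` on the homology `𝔹_•(X)`. -/
def cohSmul (B : BivData.{w} F) {X : C} (α : B.grp (𝟙 X)) (a : B.grp (F.tm X)) :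
    B.grp (F.tm X) :=
  B.tr (Category.id_comp (F.tm X)) (B.mul α a)

/-- An orientation of a bivariant theory: a canonical element `θ(f)` for every
specialized morphism, normalized and multiplicative. -/
structure BivOrientation (B : BivData.{w} F) where
  θ : ∀ ⦃X Y : C⦄ (f : X ⟶ Y), F.specialized f → B.grp f
  θ_id : ∀ (X : C), θ (𝟙 X) (F.specialized_of_isIso (𝟙 X) inferInstance) = B.one X
  θ_comp : ∀ ⦃X Y Z : C⦄ (f : X ⟶ Y) (g : Y ⟶ Z) (hf : F.specialized f)
    (hg : F.specialized g),
    θ (f ≫ g) (F.specialized_comp hf hg) = B.mul (θ f hf) (θ g hg)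

/-- A stable orientation: specialized morphisms are stable under independent
pullbacks, and the orientation is stable under independent pullbacks. -/
structure StableOrientation (B : BivData.{w} F) extends BivOrientation B where
  specialized_pullback : ∀ ⦃X Y X' Y' : C⦄ {bot : X ⟶ Y} {top : X' ⟶ Y'} {l : X' ⟶ X}
    {r : Y' ⟶ Y}, F.indep bot top l r → F.specialized bot → F.specialized top
  θ_pullback : ∀ ⦃X Y X' Y' : C⦄ {bot : X ⟶ Y} {top : X' ⟶ Y'} {l : X' ⟶ X}
    {r : Y' ⟶ Y} (hsq : F.indep bot top l r) (hs : F.specialized bot),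
    B.pull hsq (θ bot hs) = θ top (specialized_pullback hsq hs)

variable {B : BivData.{w} F}

/-- The Gysin pushforward `f_! : 𝔹^•(X) → 𝔹^•(Y)`, `f_!(α) = f_*(α • θ(f))`, along a
confined and specialized morphism. -/
def BivOrientation.gysinPush (O : BivOrientation B) {X Y : C} (f : X ⟶ Y)
    (hc : F.confined f) (hs : F.specialized f) : B.grp (𝟙 X) → B.grp (𝟙 Y) :=
  fun α => B.push f (𝟙 Y) hc
    (B.tr (show 𝟙 X ≫ f = f ≫ 𝟙 Y by simp) (B.mul α (O.θ f hs)))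

/-- The Gysin pullback `g^! : 𝔹_•(Y) → 𝔹_•(X)`, `g^!(β) = θ(g) • β`, along a
specialized morphism. -/
def BivOrientation.gysinPull (O : BivOrientation B) {X Y : C} (g : X ⟶ Y)
    (hs : F.specialized g) : B.grp (F.tm Y) → B.grp (F.tm X) :=
  fun a => B.tr (F.isTerminal_pt.hom_ext _ _) (B.mul (O.θ g hs) a)

/-- A Grothendieck transformation between two bivariant theories on the same
functoriality: a family of group homomorphisms commuting with bivariant
pushforwards, pullbacks and products. -/
structure GrothTrans (B₁ : BivData.{w} F) (B₂ : BivData.{w'} F) where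
  map : ∀ ⦃X Y : C⦄ (f : X ⟶ Y), B₁.grp f →+ B₂.grp f
  map_push : ∀ ⦃X X' Y : C⦄ (g : X ⟶ X') (h : X' ⟶ Y) (hg : F.confined g)
    (α : B₁.grp (g ≫ h)),
    map h (B₁.push g h hg α) = B₂.push g h hg (map (g ≫ h) α)
  map_pull : ∀ ⦃X Y X' Y' : C⦄ {bot : X ⟶ Y} {top : X' ⟶ Y'} {l : X' ⟶ X}
    {r : Y' ⟶ Y} (hsq : F.indep bot top l r) (α : B₁.grp bot),
    map top (B₁.pull hsq α) = B₂.pull hsq (map bot α)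
  map_mul : ∀ ⦃X Y Z : C⦄ {f : X ⟶ Y} {g : Y ⟶ Z} (α : B₁.grp f) (β : B₁.grp g),
    map (f ≫ g) (B₁.mul α β) = B₂.mul (map f α) (map g β)

/-- `𝒞`-independence, part 1: every Cartesian square whose right-hand vertical side
is confined is independent. -/
def CIndepRight (F : BivFun C) : Prop :=
  ∀ ⦃X Y X' Y' : C⦄ {bot : X ⟶ Y} {top : X' ⟶ Y'} {l : X' ⟶ X} {r : Y' ⟶ Y},
    IsPullback top l r bot → F.confined r → F.indep bot top l r

/-- `𝒞`-independence, part 2: every Cartesian square whose bottom horizontal side is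
confined is independent. -/
def CIndepBot (F : BivFun C) : Prop :=
  ∀ ⦃X Y X' Y' : C⦄ {bot : X ⟶ Y} {top : X' ⟶ Y'} {l : X' ⟶ X} {r : Y' ⟶ Y},
    IsPullback top l r bot → F.confined bot → F.indep bot top l r

/-- The class of independent squares is symmetric: independence of a square implies
independence of its transpose. -/
def IndepSymm (F : BivFun C) : Prop :=
  ∀ ⦃X Y X' Y' : C⦄ {bot : X ⟶ Y} {top : X' ⟶ Y'} {l : X' ⟶ X} {r : Y' ⟶ Y},
    F.indep bot top l r → F.indep r l top bot

/-- Specialized morphisms are stable under independent pullbacks. -/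
def SpecStable (F : BivFun C) : Prop :=
  ∀ ⦃X Y X' Y' : C⦄ {bot : X ⟶ Y} {top : X' ⟶ Y'} {l : X' ⟶ X} {r : Y' ⟶ Y},
    F.indep bot top l r → F.specialized bot → F.specialized top

/-- A bivariant theory (with a symmetric class of independent squares) is commutative
if `g^*(α) • β = f^*(β) • α` for every independent square with bottom `f` and right
side `g`, where `f^*` is the pullback along the transposed square. -/
def IsCommutative (B : BivData.{w} F) : Prop :=
  ∀ ⦃X Y X' Y' : C⦄ {f : X ⟶ Y} {top : X' ⟶ Y'} {l : X' ⟶ X} {g : Y' ⟶ Y}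
    (hsq : F.indep f top l g) (hsq' : F.indep g l top f)
    (α : B.grp f) (β : B.grp g),
    B.mul (B.pull hsq α) β =
      B.tr (F.indep_isPullback hsq).w.symm (B.mul (B.pull hsq' β) α)

/-- A bivariant cycle over `φ : X ⟶ Y`: a confined morphism `m : V ⟶ X` such that the
composite `V ⟶ Y` is specialized. -/
structure PreCyc (F : BivFun C) {X Y : C} (φ : X ⟶ Y) : Type max u v where
  V : C
  m : V ⟶ X
  conf : F.confined m
  spec : F.specialized (m ≫ φ)

/-- Two cycles are isomorphic when there is an isomorphism of their sources commuting
with the structure morphisms. -/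
def CycIso {F : BivFun C} {X Y : C} {φ : X ⟶ Y} (c c' : PreCyc F φ) : Prop :=
  ∃ e : c.V ≅ c'.V, e.hom ≫ c'.m = c.m

/-- A presentation of the universal bivariant theory `𝕄`: the groups `𝕄(X → Y)` are
free on the isomorphism classes of cycles `[V → X]` (expressed by the universal
property `free`), and the bivariant operations act on cycle classes by the standard
formulas: pushforward relabels, pullback takes a base change, the product takes the
double fiber product, and the unit is the identity cycle. -/
structure MPresentation (M : BivData.{w} F) where
  cls : ∀ ⦃X Y : C⦄ {φ : X ⟶ Y}, PreCyc F φ → M.grp φ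
  cls_iso : ∀ ⦃X Y : C⦄ {φ : X ⟶ Y} (c c' : PreCyc F φ), CycIso c c' → cls c = cls c'
  free : ∀ ⦃X Y : C⦄ (φ : X ⟶ Y) (H : Type w') [AddCommGroup H]
    (v : PreCyc F φ → H), (∀ c c', CycIso c c' → v c = v c') →
    ∃! ψ : M.grp φ →+ H, ∀ c, ψ (cls c) = v c
  cls_push : ∀ ⦃X X' Y : C⦄ (g : X ⟶ X') (φ : X' ⟶ Y) (hg : F.confined g)
    (c : PreCyc F (g ≫ φ)),
    M.push g φ hg (cls c) =
      cls ⟨c.V, c.m ≫ g, F.confined_comp c.conf hg,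
        (Category.assoc c.m g φ).symm ▸ c.spec⟩
  cls_pull : ∀ ⦃X Y X' Y' : C⦄ {bot : X ⟶ Y} {top : X' ⟶ Y'} {l : X' ⟶ X}
    {r : Y' ⟶ Y} (hsq : F.indep bot top l r) (c : PreCyc F bot)
    (V' : C) (pr : V' ⟶ c.V) (m' : V' ⟶ X') (hpb : IsPullback m' pr l c.m)
    (hspec : F.specialized (m' ≫ top)),
    M.pull hsq (cls c) = cls ⟨V', m', F.confined_pullback hpb c.conf, hspec⟩
  cls_mul : ∀ ⦃X Y Z : C⦄ {φ : X ⟶ Y} {ψ : Y ⟶ Z} (c : PreCyc F φ) (d : PreCyc F ψ)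
    (X' : C) (a : X' ⟶ X) (b : X' ⟶ d.V) (hX' : IsPullback a b φ d.m)
    (V' : C) (uu : V' ⟶ c.V) (ww : V' ⟶ X') (hV' : IsPullback uu ww c.m a)
    (hconf : F.confined (ww ≫ a)) (hspec : F.specialized ((ww ≫ a) ≫ (φ ≫ ψ))),
    M.mul (cls c) (cls d) = cls ⟨V', ww ≫ a, hconf, hspec⟩
  cls_one : ∀ X : C,
    M.one X = cls ⟨X, 𝟙 X, F.confined_of_isIso (𝟙 X) inferInstance,
      F.specialized_of_isIso (𝟙 X ≫ 𝟙 X) inferInstance⟩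

/-- The canonical orientation `θ(f) = [X = X]` of the universal bivariant theory. -/
def MPresentation.thetaEl {M : BivData.{w} F} (P : MPresentation.{w, w'} M)
    {X Y : C} (f : X ⟶ Y) (hs : F.specialized f) : M.grp f :=
  P.cls ⟨X, 𝟙 X, F.confined_of_isIso (𝟙 X) inferInstance, by simpa using hs⟩

theorem BivData.tr_tr (B : BivData.{w} F) {X Y : C} {f g h : X ⟶ Y} (e : f = g) (e' : g = h)
    (α : B.grp f) : B.tr e' (B.tr e α) = B.tr (e.trans e') α := by
  subst e e'; rfl

theorem BivData.push_congr (B : BivData.{w} F) {X X' Y : C} {g g' : X ⟶ X'} (e : g = g')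
    (h : X' ⟶ Y) (hg : F.confined g) (α : B.grp (g ≫ h)) :
    B.push g h hg α = B.push g' h (e ▸ hg) (B.tr (by rw [e]) α) := by
  subst e; rfl

theorem BivData.tr_push (B : BivData.{w} F) {X X' Y : C} (g : X ⟶ X') {h h' : X' ⟶ Y}
    (e : h = h') (hg : F.confined g) (α : B.grp (g ≫ h)) :
    B.tr e (B.push g h hg α) = B.push g h' hg (B.tr (by rw [e]) α) := by
  subst e; rfl

theorem BivOrientation.tr_θ (O : BivOrientation B) {X Y : C} {f g : X ⟶ Y} (e : f = g)
    (hf : F.specialized f) : B.tr e (O.θ f hf) = O.θ g (e ▸ hf) := by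
  subst e; rfl

/-- The value `m_*(θ(m ≫ φ))` of the universal transformation on a cycle. -/
def BivOrientation.cycleValue (O : BivOrientation B) {X Y : C} {φ : X ⟶ Y}
    (c : PreCyc F φ) : B.grp φ :=
  B.push c.m φ c.conf (O.θ (c.m ≫ φ) c.spec)

theorem StableOrientation.push_iso_θ (hCIr : CIndepRight F) (hB : IsBivTheory B)
    (O : StableOrientation B) {V W Y : C} (e : V ⟶ W) [IsIso e] (k : W ⟶ Y)
    (he : F.confined e) (hk : F.specialized k) (hek : F.specialized (e ≫ k)) :
    B.push e k he (O.θ (e ≫ k) hek) = O.θ k hk := by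
  have hpb : IsPullback (e ≫ k) e (𝟙 Y) (𝟙 W ≫ k) :=
    (IsPullback.of_vert_isIso ⟨by simp⟩)
  have hbig : F.indep (𝟙 W ≫ k) (e ≫ k) e (𝟙 Y) :=
    hCIr hpb (F.confined_of_isIso _ inferInstance)
  have hleft : IsPullback e e (𝟙 W) (𝟙 W) := IsPullback.of_vert_isIso ⟨by simp⟩
  have h1 : F.specialized (𝟙 W ≫ k) := by simpa using hk
  have := hB.push_pull (𝟙 W) k e k e (𝟙 W) (𝟙 Y) (F.confined_of_isIso _ inferInstance)
    hleft hbig (F.indep_vert_id k) (O.θ (𝟙 W ≫ k) h1)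
  rw [hB.pull_id, hB.push_id, O.tr_θ, O.θ_pullback] at this
  exact this.symm

theorem StableOrientation.cycleValue_eq_of_cycIso (hCIr : CIndepRight F) (hB : IsBivTheory B)
    (O : StableOrientation B) {X Y : C} {φ : X ⟶ Y} (c c' : PreCyc F φ) (h : CycIso c c') :
    O.cycleValue c = O.cycleValue c' := by
  obtain ⟨V, m, hm, hs⟩ := c
  obtain ⟨V', m', hm', hs'⟩ := c'
  obtain ⟨e, he⟩ := h
  dsimp only at e he
  subst he
  have hs₂ : F.specialized (e.hom ≫ m' ≫ φ) := by simpa using hs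
  have he : F.confined e.hom := F.confined_of_isIso _ inferInstance
  change B.push (e.hom ≫ m') φ hm (O.θ _ hs) = B.push m' φ hm' (O.θ _ hs')
  rw [← O.push_iso_θ hCIr hB e.hom (m' ≫ φ) he hs' hs₂, hB.push_comp, O.tr_θ]

theorem MPresentation.addHom_ext {M : BivData.{w} F} (P : MPresentation.{w, w'} M)
    {X Y : C} {φ : X ⟶ Y} {H : Type w'} [AddCommGroup H] {ψ ψ' : M.grp φ →+ H}
    (h : ∀ c, ψ (P.cls c) = ψ' (P.cls c)) : ψ = ψ' :=
  (P.free φ H (fun c => ψ' (P.cls c)) fun c c' hc => by rw [P.cls_iso c c' hc]).unique h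
    fun _ => rfl

theorem MPresentation.cls_eq_push_thetaEl {M : BivData.{w} F} (P : MPresentation.{w, w'} M)
    {X Y : C} {φ : X ⟶ Y} (c : PreCyc F φ) :
    P.cls c = M.push c.m φ c.conf (P.thetaEl (c.m ≫ φ) c.spec) := by
  rw [MPresentation.thetaEl, P.cls_push]
  exact P.cls_iso _ _ ⟨Iso.refl _, by simp⟩

theorem BivOrientation.cycleValue_push (hB : IsBivTheory B) (O : BivOrientation B)
    {X X' Y : C} (g : X ⟶ X') (φ : X' ⟶ Y) (hg : F.confined g) (c : PreCyc F (g ≫ φ))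
    (hs : F.specialized ((c.m ≫ g) ≫ φ)) :
    O.cycleValue ⟨c.V, c.m ≫ g, F.confined_comp c.conf hg, hs⟩ =
      B.push g φ hg (O.cycleValue c) := by
  simp only [BivOrientation.cycleValue]
  rw [hB.push_comp, O.tr_θ]

theorem StableOrientation.cycleValue_pull (hB : IsBivTheory B) (hCIb : CIndepBot F)
    (O : StableOrientation B) {X Y X' Y' : C} {bot : X ⟶ Y} {top : X' ⟶ Y'} {l : X' ⟶ X}
    {r : Y' ⟶ Y} (hsq : F.indep bot top l r) (c : PreCyc F bot)
    {V' : C} {pr : V' ⟶ c.V} {m' : V' ⟶ X'} (hpb : IsPullback m' pr l c.m)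
    (hspec : F.specialized (m' ≫ top)) :
    O.cycleValue ⟨V', m', F.confined_pullback hpb c.conf, hspec⟩ =
      B.pull hsq (O.cycleValue c) := by
  have hbig := F.indep_hcomp (hCIb hpb c.conf) hsq
  simp only [BivOrientation.cycleValue]
  rw [hB.push_pull c.m bot m' top pr l r c.conf hpb hbig hsq, O.θ_pullback]

theorem StableOrientation.cycleValue_mul (hB : IsBivTheory B) (O : StableOrientation B)
    {X Y Z : C} {φ : X ⟶ Y} {ψ : Y ⟶ Z} (c : PreCyc F φ) (d : PreCyc F ψ)
    {X' : C} {a : X' ⟶ X} {b : X' ⟶ d.V} {V' : C} {uu : V' ⟶ c.V} {ww : V' ⟶ X'}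
    (hV' : IsPullback uu ww c.m a) (hsq : F.indep (c.m ≫ φ) (ww ≫ b) uu d.m)
    (hconf : F.confined (ww ≫ a)) (hspec : F.specialized ((ww ≫ a) ≫ (φ ≫ ψ))) :
    O.cycleValue ⟨V', ww ≫ a, hconf, hspec⟩ =
      B.mul (O.cycleValue c) (O.cycleValue d) := by
  simp only [BivOrientation.cycleValue]
  rw [← hB.push_mul, ← hB.proj_formula hsq, O.θ_pullback, ← O.θ_comp, O.tr_θ, B.tr_push,
    O.tr_θ, hB.push_comp, O.tr_θ, B.push_congr hV'.w, O.tr_θ]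

/-- The additive extension of `cycleValue` to the universal bivariant theory. -/
noncomputable def StableOrientation.universalMap (hCIr : CIndepRight F) (hB : IsBivTheory B)
    (O : StableOrientation B) {M : BivData.{u'} F} (P : MPresentation.{u', w} M)
    {X Y : C} (φ : X ⟶ Y) : M.grp φ →+ B.grp φ :=
  (P.free φ (B.grp φ) O.cycleValue (O.cycleValue_eq_of_cycIso hCIr hB)).choose

theorem StableOrientation.universalMap_cls (hCIr : CIndepRight F) (hB : IsBivTheory B)
    (O : StableOrientation B) {M : BivData.{u'} F} (P : MPresentation.{u', w} M)
    {X Y : C} {φ : X ⟶ Y} (c : PreCyc F φ) :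
    O.universalMap hCIr hB P φ (P.cls c) = O.cycleValue c :=
  (P.free φ (B.grp φ) O.cycleValue (O.cycleValue_eq_of_cycIso hCIr hB)).choose_spec.1 c

/-- Pushforward as an additive homomorphism. -/
def IsBivTheory.pushHom (hB : IsBivTheory B) {X X' Y : C} (g : X ⟶ X') (h : X' ⟶ Y)
    (hg : F.confined g) : B.grp (g ≫ h) →+ B.grp h :=
  AddMonoidHom.mk' (B.push g h hg) (hB.push_add g h hg)

/-- Pullback as an additive homomorphism. -/
def IsBivTheory.pullHom (hB : IsBivTheory B) {X Y X' Y' : C} {bot : X ⟶ Y} {top : X' ⟶ Y'}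
    {l : X' ⟶ X} {r : Y' ⟶ Y} (hsq : F.indep bot top l r) : B.grp bot →+ B.grp top :=
  AddMonoidHom.mk' (B.pull hsq) (hB.pull_add hsq)

/-- The product as a biadditive homomorphism. -/
def IsBivTheory.mulHom (hB : IsBivTheory B) {X Y Z : C} (f : X ⟶ Y) (g : Y ⟶ Z) :
    B.grp f →+ B.grp g →+ B.grp (f ≫ g) :=
  AddMonoidHom.mk' (fun α => AddMonoidHom.mk' (B.mul α) (hB.mul_add_right α))
    fun α α' => AddMonoidHom.ext (hB.mul_add_left α α')

/-- The universal orientation preserving Grothendieck transformation. -/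
noncomputable def StableOrientation.universalTrans (hCIr : CIndepRight F)
    (hCIb : CIndepBot F) (hB : IsBivTheory B) (O : StableOrientation B)
    {M : BivData.{u'} F} (hM : IsBivTheory M) (P : MPresentation.{u', w} M) :
    GrothTrans M B where
  map _ _ φ := O.universalMap hCIr hB P φ
  map_push X X' Y g h hg := by
    refine DFunLike.congr_fun (P.addHom_ext
      (ψ := (O.universalMap hCIr hB P h).comp (hM.pushHom g h hg))
      (ψ' := (hB.pushHom g h hg).comp (O.universalMap hCIr hB P (g ≫ h))) fun c => ?_)
    change O.universalMap hCIr hB P h (M.push g h hg (P.cls c)) =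
      B.push g h hg (O.universalMap hCIr hB P (g ≫ h) (P.cls c))
    rw [P.cls_push, O.universalMap_cls, O.universalMap_cls, O.cycleValue_push hB]
  map_pull X Y X' Y' bot top l r hsq := by
    refine DFunLike.congr_fun (P.addHom_ext
      (ψ := (O.universalMap hCIr hB P top).comp (hM.pullHom hsq))
      (ψ' := (hB.pullHom hsq).comp (O.universalMap hCIr hB P bot)) fun c => ?_)
    change O.universalMap hCIr hB P top (M.pull hsq (P.cls c)) =
      B.pull hsq (O.universalMap hCIr hB P bot (P.cls c))
    have := F.hasPullbacks
    have hpb := IsPullback.of_hasPullback l c.m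
    have hspec := O.specialized_pullback (F.indep_hcomp (hCIb hpb c.conf) hsq) c.spec
    rw [P.cls_pull hsq c _ _ _ hpb hspec, O.universalMap_cls, O.universalMap_cls,
      O.cycleValue_pull hB hCIb hsq c hpb hspec]
  map_mul X Y Z f g α β := by
    refine DFunLike.congr_fun (P.addHom_ext
      (ψ := (O.universalMap hCIr hB P (f ≫ g)).comp ((hM.mulHom f g).flip β))
      (ψ' := ((hB.mulHom f g).flip (O.universalMap hCIr hB P g β)).comp
        (O.universalMap hCIr hB P f)) fun c => ?_) α
    refine DFunLike.congr_fun (P.addHom_ext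
      (ψ := (O.universalMap hCIr hB P (f ≫ g)).comp (hM.mulHom f g (P.cls c)))
      (ψ' := (hB.mulHom f g (O.universalMap hCIr hB P f (P.cls c))).comp
        (O.universalMap hCIr hB P g)) fun d => ?_) β
    change O.universalMap hCIr hB P (f ≫ g) (M.mul (P.cls c) (P.cls d)) =
      B.mul (O.universalMap hCIr hB P f (P.cls c)) (O.universalMap hCIr hB P g (P.cls d))
    have := F.hasPullbacks
    have hX := IsPullback.of_hasPullback f d.m
    have hV := IsPullback.of_hasPullback c.m (pullback.fst f d.m)
    have hsq := hCIr (hV.flip.paste_horiz hX.flip) d.conf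
    have hconf : F.confined (pullback.snd c.m (pullback.fst f d.m) ≫ pullback.fst f d.m) := by
      rw [← hV.w]
      exact F.confined_comp (F.confined_pullback (F.indep_isPullback hsq).flip d.conf) c.conf
    have hspec := F.specialized_comp (O.specialized_pullback hsq c.spec) d.spec
    have hcomp : (pullback.snd c.m (pullback.fst f d.m) ≫ pullback.snd f d.m) ≫ d.m ≫ g =
        (pullback.snd c.m (pullback.fst f d.m) ≫ pullback.fst f d.m) ≫ f ≫ g := by
      simp only [Category.assoc, pullback.condition_assoc]
    rw [hcomp] at hspec
    rw [P.cls_mul c d _ _ _ hX _ _ _ hV hconf hspec, O.universalMap_cls, O.universalMap_cls,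
      O.universalMap_cls, O.cycleValue_mul hB c d hV hsq hconf hspec]

/-- Assume the class of independent squares is symmetric, the
functoriality satisfies `𝒞`-independence, and specialized morphisms are stable under
independent pullbacks.  Let `𝔹` be a stably oriented bivariant theory.  Then there
exists a unique orientation preserving Grothendieck transformation `η : 𝕄 → 𝔹` from
the universal bivariant theory `𝕄`, and necessarily
`η([V →f X]) = f_*(θ_𝔹(g))` where `g : V ⟶ Y` is the composite. -/
theorem universal_theory_universal_property {C : Type u} [Category.{v} C]
    (F : BivFun C) (hsymm : IndepSymm F) (hCIr : CIndepRight F) (hCIb : CIndepBot F)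
    (hss : SpecStable F) (M : BivData.{w} F) (hM : IsBivTheory M)
    (P : MPresentation.{w, w'} M) (B : BivData.{w'} F) (hB : IsBivTheory B)
    (O : StableOrientation B) :
    ∃ η : GrothTrans M B,
      (∀ (X Y : C) (f : X ⟶ Y) (hs : F.specialized f),
        η.map f (P.thetaEl f hs) = O.θ f hs) ∧
      (∀ η' : GrothTrans M B,
        (∀ (X Y : C) (f : X ⟶ Y) (hs : F.specialized f),
          η'.map f (P.thetaEl f hs) = O.θ f hs) → η' = η) ∧
      (∀ (X Y : C) (φ : X ⟶ Y) (c : PreCyc F φ),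
        η.map φ (P.cls c) = B.push c.m φ c.conf (O.θ (c.m ≫ φ) c.spec)) := by
  refine ⟨O.universalTrans hCIr hCIb hB hM P, fun X Y f hs => ?_, fun η' hη' => ?_,
    fun X Y φ c => O.universalMap_cls hCIr hB P c⟩
  · change O.universalMap hCIr hB P f (P.cls _) = _
    rw [O.universalMap_cls, BivOrientation.cycleValue, hB.push_id, O.tr_θ]
  · obtain ⟨map, map_push, _, _⟩ := η'
    have : map = (O.universalTrans hCIr hCIb hB hM P).map := by
      funext X Y φ
      refine P.addHom_ext fun c => ?_
      refine Eq.trans ?_ (O.universalMap_cls hCIr hB P c).symm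
      rw [P.cls_eq_push_thetaEl c, map_push]
      exact congrArg _ (hη' _ _ _ _)
    subst this
    rfl
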